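/- There exist absolute constants c, C > 0 such that for all integers L, d ≥ 16 the following holds: if G is an n-vertex graph with average degree d(G) ≥ d which is d-degenerate, then at least one of the following holds. (1) There is a partition V(G) = A ∪ B with |A| ≥ L|B|/2 and such that the number of edges with one endpoint in A and one in B is at least nd/8. (2) There is an induced subgraph H ⊆ G with Δ(H) ≤ C·d(H)·(log₂ L)² and average degree d(H) ≥ c·d/(log₂ L)². -/

import Mathlib

open Finset

/-- The average degree `2|E|/|V|` of a finite simple graph. -/
noncomputable def avgDeg {V : Type*} [Fintype V] (G : SimpleGraph V) : ℝ :=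
  2 * G.edgeSet.ncard / Fintype.card V

/-- The degree of a vertex. -/
noncomputable def deg {V : Type*} (G : SimpleGraph V) (v : V) : ℕ :=
  (G.neighborSet v).ncard

/-- `G` contains `K_{s,s}` as a (not necessarily induced) subgraph. -/
def HasKssSubgraph {V : Type*} (G : SimpleGraph V) (s : ℕ) : Prop :=
  ∃ f : completeBipartiteGraph (Fin s) (Fin s) →g G, Function.Injective f

/-- `G` contains no cycle of length 4, even as a non-induced subgraph. -/
def C4Free {V : Type*} (G : SimpleGraph V) : Prop :=
  ¬ ∃ a b c d : V, a ≠ b ∧ a ≠ c ∧ a ≠ d ∧ b ≠ c ∧ b ≠ d ∧ c ≠ d ∧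
      G.Adj a b ∧ G.Adj b c ∧ G.Adj c d ∧ G.Adj d a

/-- The balanced subdivision of `K_h` in which every edge of `K_h` is replaced by a
path with exactly `ℓ` edges (intended for `ℓ ≥ 2`): branch vertices are `Fin h`,
and each pair `a < b` gets a path of `ℓ - 1` new internal vertices. -/
def balancedSubdivision (h ℓ : ℕ) :
    SimpleGraph (Fin h ⊕ ({p : Fin h × Fin h // p.1 < p.2} × Fin (ℓ - 1))) :=
  SimpleGraph.fromRel (fun x y =>
    match x, y with
    | Sum.inl u, Sum.inr ⟨⟨⟨a, b⟩, _⟩, i⟩ => (u = a ∧ (i : ℕ) = 0) ∨ (u = b ∧ (i : ℕ) = ℓ - 2)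
    | Sum.inr ⟨e, i⟩, Sum.inr ⟨e', j⟩ => e = e' ∧ (j : ℕ) = (i : ℕ) + 1
    | _, _ => False)

/-- `G` contains an induced proper balanced subdivision of `K_h`. -/
def HasInducedBalancedSubdivision {V : Type*} (G : SimpleGraph V) (h : ℕ) : Prop :=
  ∃ ℓ : ℕ, 2 ≤ ℓ ∧ Nonempty (balancedSubdivision h ℓ ↪g G)

/-- The number of edges of `G` with one endpoint in `A` and the other in `B`
(for disjoint `A`, `B`). -/
noncomputable def crossEdges {V : Type*} (G : SimpleGraph V) (A B : Set V) : ℕ :=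
  Set.ncard {p : V × V | p.1 ∈ A ∧ p.2 ∈ B ∧ G.Adj p.1 p.2}

/-- `G` is `d`-degenerate: every (induced) subgraph has a vertex of degree at most `d`. -/
def Degenerate {V : Type*} (G : SimpleGraph V) (d : ℕ) : Prop :=
  ∀ s : Finset V, s.Nonempty → ∃ v ∈ s, ((s : Set V) ∩ G.neighborSet v).ncard ≤ d

/-- The 1-subdivision of the multihypergraph with hyperedges `edges e`, `e : E`,
on vertex set `V`. -/
def oneSubdivision {E V : Type*} (edges : E → Finset V) : SimpleGraph (E ⊕ V) :=
  SimpleGraph.fromRel (fun x y =>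
    match x, y with
    | Sum.inl a, Sum.inr b => b ∈ edges a
    | _, _ => False)

/-- The 1-subdivision of a simple graph `G`. -/
def graphOneSubdivision {W : Type*} (G : SimpleGraph W) : SimpleGraph (G.edgeSet ⊕ W) :=
  SimpleGraph.fromRel (fun x y =>
    match x, y with
    | Sum.inl e, Sum.inr w => w ∈ (e : Sym2 W)
    | _, _ => False)

/-- `I` is an independent set of `G`. -/
def IndepSet {V : Type*} (G : SimpleGraph V) (I : Set V) : Prop :=
  I.Pairwise fun u v => ¬ G.Adj u v

/-- `G` has a clique on `k` vertices. -/
def HasClique {V : Type*} (G : SimpleGraph V) (k : ℕ) : Prop :=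
  ∃ t : Finset V, G.IsNClique k t


namespace AlmostRegular

open Classical in
/-- The adjacency indicator of `G`. -/
noncomputable def adjInd {V : Type*} (G : SimpleGraph V) (x y : V) : ℝ :=
  if G.Adj x y then 1 else 0

/-- The number of neighbours of `v` in `s`. -/
noncomputable def degIn {V : Type*} (G : SimpleGraph V) (s : Finset V) (v : V) : ℝ :=
  ∑ u ∈ s, adjInd G v u

section Basic

variable {V : Type*} (G : SimpleGraph V)

lemma adjInd_comm (x y : V) : adjInd G x y = adjInd G y x := by
  unfold adjInd; rw [G.adj_comm]

lemma adjInd_nonneg (x y : V) : 0 ≤ adjInd G x y := by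
  unfold adjInd; split_ifs <;> norm_num

lemma adjInd_mul_self (x y : V) : adjInd G x y * adjInd G x y = adjInd G x y := by
  unfold adjInd; split_ifs <;> norm_num

lemma degIn_nonneg (s : Finset V) (v : V) : 0 ≤ degIn G s v :=
  Finset.sum_nonneg fun _ _ => adjInd_nonneg G _ _

lemma degIn_mono {s t : Finset V} (h : s ⊆ t) (v : V) : degIn G s v ≤ degIn G t v :=
  Finset.sum_le_sum_of_subset_of_nonneg h fun _ _ _ => adjInd_nonneg G _ _

lemma sum_degIn_comm (s t : Finset V) :
    ∑ v ∈ s, degIn G t v = ∑ v ∈ t, degIn G s v := by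
  unfold degIn
  rw [Finset.sum_comm]
  simp only [adjInd_comm]

open Classical in
lemma degIn_eq_card_filter (s : Finset V) (v : V) :
    degIn G s v = (#{u ∈ s | G.Adj v u} : ℝ) := by
  simp [degIn, adjInd]

lemma degIn_eq_ncard (s : Finset V) (v : V) :
    degIn G s v = (((s : Set V) ∩ G.neighborSet v).ncard : ℝ) := by
  classical
  rw [degIn_eq_card_filter, ← Set.ncard_coe_finset]
  congr 2
  ext u
  simp

lemma degIn_union_le [DecidableEq V] (s t : Finset V) (v : V) :
    degIn G (s ∪ t) v ≤ degIn G s v + degIn G t v := by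
  unfold degIn
  rw [← Finset.sum_union_inter]
  exact le_add_of_nonneg_right (Finset.sum_nonneg fun _ _ => adjInd_nonneg G _ _)

lemma deg_induce (s : Finset V) (v : (s : Set V)) :
    (deg (G.induce (s : Set V)) v : ℝ) = degIn G s v := by
  rw [degIn_eq_ncard, deg, ← Set.ncard_image_of_injective _ Subtype.val_injective]
  congr 2
  ext u
  simp only [Set.mem_image, SimpleGraph.mem_neighborSet, SimpleGraph.comap_adj, Set.mem_inter_iff,
    Subtype.exists, SimpleGraph.induce]
  constructor
  · rintro ⟨a, ha, h, rfl⟩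
    exact ⟨ha, h⟩
  · rintro ⟨ha, h⟩
    exact ⟨u, ha, h, rfl⟩

lemma sum_degIn_univ_eq [Fintype V] :
    ∑ v, degIn G Finset.univ v = 2 * (G.edgeSet.ncard : ℝ) := by
  classical
  have h := G.sum_degrees_eq_twice_card_edges
  rw [← Set.ncard_coe_finset, SimpleGraph.coe_edgeFinset] at h
  have h2 : ∀ v, degIn G Finset.univ v = (G.degree v : ℝ) := by
    intro v
    rw [degIn_eq_card_filter, ← SimpleGraph.card_neighborFinset_eq_degree,
      SimpleGraph.neighborFinset_eq_filter]
  simp only [h2]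
  exact_mod_cast h

lemma avgDeg_eq [Fintype V] :
    avgDeg G = (∑ v, degIn G Finset.univ v) / Fintype.card V := by
  rw [sum_degIn_univ_eq, avgDeg]

lemma avgDeg_induce (s : Finset V) :
    avgDeg (G.induce (s : Set V)) = (∑ v ∈ s, degIn G s v) / #s := by
  rw [avgDeg_eq]
  congr 1
  · rw [← Finset.sum_coe_sort s]
    refine Finset.sum_congr rfl fun v _ => ?_
    unfold degIn
    rw [← Finset.sum_coe_sort s]
    rfl
  · simp

lemma crossEdges_eq (A B : Finset V) :
    (crossEdges G (A : Set V) (B : Set V) : ℝ) = ∑ v ∈ A, degIn G B v := by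
  classical
  have : {p : V × V | p.1 ∈ (A : Set V) ∧ p.2 ∈ (B : Set V) ∧ G.Adj p.1 p.2}
      = ((A ×ˢ B).filter fun p => G.Adj p.1 p.2 : Finset (V × V)) := by
    ext p
    simp [and_assoc]
  rw [crossEdges, this, Set.ncard_coe_finset, Finset.card_filter, Finset.sum_product]
  push_cast
  rfl

lemma sum_degIn_le_of_degenerate {d : ℕ} (hG : Degenerate G d) (s : Finset V) :
    ∑ v ∈ s, degIn G s v ≤ 2 * d * #s := by
  classical
  induction s using Finset.strongInduction with
  | H s ih =>
    rcases s.eq_empty_or_nonempty with rfl | hs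
    · simp
    obtain ⟨v, hv, hd⟩ := hG s hs
    have hd' : degIn G s v ≤ d := by
      rw [degIn_eq_ncard]; exact_mod_cast hd
    have h1 := ih _ (Finset.erase_ssubset hv)
    have hsplit : ∀ w, degIn G s w = adjInd G w v + degIn G (s.erase v) w := fun w =>
      (Finset.add_sum_erase s _ hv).symm
    have h2 : ∑ w ∈ s, degIn G s w
        = degIn G s v + (degIn G (s.erase v) v + ∑ w ∈ s.erase v, degIn G (s.erase v) w) := by
      rw [← Finset.add_sum_erase s _ hv]
      congr 1
      rw [Finset.sum_congr rfl fun w _ => hsplit w, Finset.sum_add_distrib]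
      congr 1
      exact Finset.sum_congr rfl fun w _ => adjInd_comm G _ _
    have h3 := degIn_mono G (Finset.erase_subset v s) v
    have h4 : (#s : ℝ) = #(s.erase v) + 1 := by
      exact_mod_cast (Finset.card_erase_add_one hv).symm
    rw [h2, h4]
    linarith

end Basic

/-- Every symmetric weighting admits a `q`-colouring in which the off-diagonal monochromatic
weight is at most a `1/q` proportion of the total weight. -/
lemma exists_coloring_sum_mono_le {V : Type*} [DecidableEq V] {q : ℕ} (hq : 0 < q)
    (m : V → V → ℝ) (hm : ∀ x y, m x y = m y x) (hm0 : ∀ x, 0 ≤ m x x) (s : Finset V) :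
    ∃ f : V → Fin q, ∑ x ∈ s, ∑ y ∈ s, (if f x = f y then m x y else 0)
      ≤ ∑ x ∈ s, m x x + (∑ x ∈ s, ∑ y ∈ s, m x y) / q := by
  have : NeZero q := ⟨hq.ne'⟩
  have hq' : (0 : ℝ) < q := by exact_mod_cast hq
  induction s using Finset.induction_on with
  | empty => exact ⟨fun _ => 0, by simp⟩
  | insert a s ha ih =>
    obtain ⟨f, hf⟩ := ih
    obtain ⟨c, -, hc⟩ : ∃ c ∈ (Finset.univ : Finset (Fin q)),
        ∑ y ∈ s, (if c = f y then m a y else 0) ≤ (∑ y ∈ s, m a y) / q := by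
      refine Finset.exists_le_of_sum_le ⟨0, Finset.mem_univ _⟩ ?_
      rw [Finset.sum_comm]
      simp [mul_div_cancel₀ _ hq'.ne']
    have hne : ∀ x ∈ s, Function.update f a c x = f x := fun x hx =>
      Function.update_of_ne (ne_of_mem_of_not_mem hx ha) _ _
    refine ⟨Function.update f a c, ?_⟩
    have e1 : ∀ g : V → V → ℝ, (∀ x y, g x y = g y x) →
        ∑ x ∈ insert a s, ∑ y ∈ insert a s, g x y
          = g a a + 2 * ∑ y ∈ s, g a y + ∑ x ∈ s, ∑ y ∈ s, g x y := by
      intro g hg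
      simp only [Finset.sum_insert ha, Finset.sum_add_distrib]
      rw [Finset.sum_congr rfl fun x _ => hg x a]
      ring
    rw [e1 m hm, e1 (fun x y => if Function.update f a c x = Function.update f a c y
      then m x y else 0) (fun x y => by simp only [hm x y, eq_comm])]
    have e2 : ∑ x ∈ s, ∑ y ∈ s,
        (if Function.update f a c x = Function.update f a c y then m x y else 0)
        = ∑ x ∈ s, ∑ y ∈ s, (if f x = f y then m x y else 0) :=
      Finset.sum_congr rfl fun x hx => Finset.sum_congr rfl fun y hy => by
        rw [hne x hx, hne y hy]
    have e3 : ∑ y ∈ s,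
        (if Function.update f a c a = Function.update f a c y then m a y else 0)
        = ∑ y ∈ s, (if c = f y then m a y else 0) :=
      Finset.sum_congr rfl fun y hy => by
        rw [hne y hy, Function.update_self]
    rw [e2, e3, Finset.sum_insert ha]
    simp only [if_true]
    have : 0 ≤ m a a / q := div_nonneg (hm0 a) hq'.le
    rw [add_div, add_div, mul_div_assoc]
    linarith

/-- Some colour class `S` of a suitable `q`-colouring of `P` keeps a `1/q` share of the edges
between `P` and `Q`, up to discarding the vertices of `Q` with more than `t` neighbours in `S`. -/
lemma exists_sparsification {V : Type*} [DecidableEq V] (G : SimpleGraph V) (P Q : Finset V)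
    {q : ℕ} (hq : 0 < q) {D t α : ℝ} (ht : 0 < t) (hD : ∀ v ∈ Q, degIn G P v ≤ q * D)
    (hα : α * (#P + q * #Q) ≤ (∑ v ∈ Q, degIn G P v) * (1 - (1 + D) / t)) :
    ∃ S ⊆ P, ∃ R ⊆ Q, (∀ v ∈ R, degIn G S v ≤ t) ∧
      α * (#S + #Q) ≤ ∑ v ∈ R, degIn G S v := by
  have : NeZero q := ⟨hq.ne'⟩
  have hq' : (0 : ℝ) < q := by exact_mod_cast hq
  obtain ⟨f, hf⟩ := exists_coloring_sum_mono_le hq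
    (fun x y => ∑ v ∈ Q, adjInd G v x * adjInd G v y)
    (fun x y => Finset.sum_congr rfl fun v _ => mul_comm _ _)
    (fun x => Finset.sum_nonneg fun v _ => mul_self_nonneg _) P
  have hcls : ∀ v c, degIn G {x ∈ P | f x = c} v
      = ∑ x ∈ P, if f x = c then adjInd G v x else 0 := fun v c => by
    rw [degIn, Finset.sum_filter]
  have hfirst : ∀ v, ∑ c, degIn G {x ∈ P | f x = c} v = degIn G P v := fun v => by
    simp only [hcls]
    rw [Finset.sum_comm]
    simp [degIn]
  have hsq : ∀ v, ∑ c, degIn G {x ∈ P | f x = c} v ^ 2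
      = ∑ x ∈ P, ∑ y ∈ P, if f x = f y then adjInd G v x * adjInd G v y else 0 := fun v => by
    simp only [hcls, sq, Finset.sum_mul_sum]
    rw [Finset.sum_comm]
    refine Finset.sum_congr rfl fun x _ => ?_
    rw [Finset.sum_comm]
    refine Finset.sum_congr rfl fun y _ => ?_
    simp [eq_comm]
  have hsecond : ∑ c, ∑ v ∈ Q, degIn G {x ∈ P | f x = c} v ^ 2
      ≤ (1 + D) * ∑ v ∈ Q, degIn G P v := by
    rw [Finset.sum_comm]
    simp only [hsq]
    have e1 : ∑ v ∈ Q, ∑ x ∈ P, ∑ y ∈ P,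
        (if f x = f y then adjInd G v x * adjInd G v y else 0)
        = ∑ x ∈ P, ∑ y ∈ P,
          (if f x = f y then ∑ v ∈ Q, adjInd G v x * adjInd G v y else 0) := by
      rw [Finset.sum_comm]
      refine Finset.sum_congr rfl fun x _ => ?_
      rw [Finset.sum_comm]
      refine Finset.sum_congr rfl fun y _ => ?_
      split_ifs <;> simp
    have e2 : ∑ x ∈ P, ∑ v ∈ Q, adjInd G v x * adjInd G v x = ∑ v ∈ Q, degIn G P v := by
      rw [Finset.sum_comm]
      simp only [adjInd_mul_self, degIn]
    have e3 : ∑ x ∈ P, ∑ y ∈ P, ∑ v ∈ Q, adjInd G v x * adjInd G v y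
        = ∑ v ∈ Q, degIn G P v * degIn G P v := by
      simp only [degIn, Finset.sum_mul_sum]
      rw [Finset.sum_comm' (s := Q) (t' := P) (s' := fun _ => Q) (by tauto)]
      refine Finset.sum_congr rfl fun x _ => ?_
      rw [Finset.sum_comm]
    have e4 : ∑ v ∈ Q, degIn G P v * degIn G P v ≤ (q * D) * ∑ v ∈ Q, degIn G P v := by
      rw [Finset.mul_sum]
      exact Finset.sum_le_sum fun v hv =>
        mul_le_mul_of_nonneg_right (hD v hv) (degIn_nonneg G P v)
    rw [e2, e3] at hf
    rw [e1]
    refine hf.trans ?_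
    have : (∑ v ∈ Q, degIn G P v * degIn G P v) / q ≤ D * ∑ v ∈ Q, degIn G P v := by
      rw [div_le_iff₀ hq']
      linarith
    linarith
  have hcard : ∑ c, (#{x ∈ P | f x = c} : ℝ) = #P := by
    exact_mod_cast (Finset.card_eq_sum_card_fiberwise (f := f) (s := P) (t := Finset.univ)
      (by simp)).symm
  obtain ⟨c, -, hc⟩ : ∃ c ∈ (Finset.univ : Finset (Fin q)),
      α * (#{x ∈ P | f x = c} + #Q)
        ≤ ∑ v ∈ Q, (degIn G {x ∈ P | f x = c} v - degIn G {x ∈ P | f x = c} v ^ 2 / t) := by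
    refine Finset.exists_le_of_sum_le ⟨0, Finset.mem_univ _⟩ ?_
    rw [← Finset.mul_sum, Finset.sum_add_distrib, hcard]
    simp only [Finset.sum_sub_distrib, ← Finset.sum_div]
    rw [Finset.sum_comm, Finset.sum_congr rfl fun v _ => hfirst v]
    have h := div_le_div_of_nonneg_right hsecond ht.le
    simp only [Finset.sum_const, Finset.card_univ, Fintype.card_fin, nsmul_eq_mul]
    refine hα.trans ?_
    rw [mul_sub, mul_one, ← mul_div_assoc, mul_comm _ (1 + D)]
    linarith
  refine ⟨_, Finset.filter_subset _ _, {v ∈ Q | degIn G {x ∈ P | f x = c} v ≤ t},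
    Finset.filter_subset _ _, fun v hv => (Finset.mem_filter.1 hv).2, hc.trans ?_⟩
  rw [Finset.sum_filter]
  refine Finset.sum_le_sum fun v _ => ?_
  have h0 := degIn_nonneg G {x ∈ P | f x = c} v
  split_ifs with h
  · have : 0 ≤ degIn G {x ∈ P | f x = c} v ^ 2 / t := by positivity
    linarith
  · rw [sub_nonpos, le_div_iff₀ ht]
    nlinarith

section Classes

variable {V : Type*} (G : SimpleGraph V)

lemma sum_degIn_le_sdiff [DecidableEq V] {A R : Finset V} (hR : R ⊆ A) :
    ∑ v ∈ A, degIn G A v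
      ≤ ∑ v ∈ A \ R, degIn G (A \ R) v + 2 * ∑ v ∈ R, degIn G A v := by
  have h1 : ∀ v, degIn G A v = degIn G (A \ R) v + degIn G R v := fun v =>
    (Finset.sum_sdiff hR).symm
  have h2 : ∑ v ∈ A, degIn G A v
      = ∑ v ∈ A \ R, degIn G (A \ R) v + ∑ v ∈ A \ R, degIn G R v + ∑ v ∈ R, degIn G A v := by
    rw [← Finset.sum_sdiff hR, ← Finset.sum_add_distrib]
    simp only [h1]
  have h3 : ∑ v ∈ A \ R, degIn G R v ≤ ∑ v ∈ R, degIn G A v := by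
    rw [sum_degIn_comm]
    exact Finset.sum_le_sum fun v _ => degIn_mono G Finset.sdiff_subset v
  linarith

/-- Vertices with unusually many neighbours in their own class carry few edges. -/
lemma exists_pruning [DecidableEq V] {d : ℕ} (hd : 0 < d) (hG : Degenerate G d)
    (κ : V → ℕ) (A : Finset V)
    (hκ : ∀ v ∈ A, degIn G A v ≤ 2 ^ (κ v + 1) * d) {K : ℝ} (hK : 0 < K) :
    ∃ A' ⊆ A, (∀ v ∈ A', degIn G {u ∈ A' | κ u = κ v} v ≤ K * d) ∧
      ∑ v ∈ A, degIn G A v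
        ≤ ∑ v ∈ A', degIn G A' v + 8 * d / K * ∑ v ∈ A, 2 ^ κ v := by
  have hd' : (0 : ℝ) < d := by exact_mod_cast hd
  set R := {v ∈ A | K * d < degIn G {u ∈ A | κ u = κ v} v} with hRdef
  have hRA : R ⊆ A := Finset.filter_subset _ _
  refine ⟨A \ R, Finset.sdiff_subset, fun v hv => ?_, ?_⟩
  · rw [Finset.mem_sdiff] at hv
    refine (degIn_mono G (Finset.filter_subset_filter _ Finset.sdiff_subset) v).trans ?_
    by_contra h
    exact hv.2 (Finset.mem_filter.2 ⟨hv.1, not_le.1 h⟩)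
  refine (sum_degIn_le_sdiff G hRA).trans (add_le_add_right ?_ _)
  have hcls : ∀ j, (#{v ∈ R | κ v = j} : ℝ) ≤ 2 / K * #{v ∈ A | κ v = j} := by
    intro j
    have h1 : #{v ∈ R | κ v = j} * (K * d) ≤ ∑ v ∈ {v ∈ R | κ v = j},
        degIn G {v ∈ A | κ v = j} v := by
      rw [← nsmul_eq_mul]
      refine Finset.card_nsmul_le_sum _ _ _ fun v hv => ?_
      obtain ⟨hvR, rfl⟩ := Finset.mem_filter.1 hv
      exact (Finset.mem_filter.1 hvR).2.le
    have h2 : ∑ v ∈ {v ∈ R | κ v = j}, degIn G {v ∈ A | κ v = j} v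
        ≤ ∑ v ∈ {v ∈ A | κ v = j}, degIn G {v ∈ A | κ v = j} v :=
      Finset.sum_le_sum_of_subset_of_nonneg (Finset.filter_subset_filter _ hRA)
        fun _ _ _ => degIn_nonneg G _ _
    have h3 := h1.trans (h2.trans (sum_degIn_le_of_degenerate G hG _))
    rw [div_mul_eq_mul_div, le_div_iff₀ hK]
    nlinarith
  have hfib : ∀ T ⊆ A, ∑ v ∈ T, (2 : ℝ) ^ κ v
      = ∑ j ∈ A.image κ, #{v ∈ T | κ v = j} * (2 : ℝ) ^ j := by
    intro T hT
    rw [← Finset.sum_fiberwise_of_maps_to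
      (fun v hv => Finset.mem_image_of_mem κ (hT hv)) fun v => (2 : ℝ) ^ κ v]
    refine Finset.sum_congr rfl fun j _ => ?_
    rw [Finset.sum_congr rfl fun v hv => by rw [(Finset.mem_filter.1 hv).2]]
    simp
  have hR : ∑ v ∈ R, (2 : ℝ) ^ κ v ≤ 2 / K * ∑ v ∈ A, 2 ^ κ v := by
    rw [hfib R hRA, hfib A subset_rfl, Finset.mul_sum]
    refine Finset.sum_le_sum fun j _ => ?_
    rw [← mul_assoc]
    exact mul_le_mul_of_nonneg_right (hcls j) (by positivity)
  have hdeg : ∑ v ∈ R, degIn G A v ≤ 2 * d * ∑ v ∈ R, (2 : ℝ) ^ κ v := by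
    rw [Finset.mul_sum]
    refine Finset.sum_le_sum fun v hv => (hκ v (hRA hv)).trans (le_of_eq ?_)
    ring
  calc 2 * ∑ v ∈ R, degIn G A v ≤ 2 * (2 * d * (2 / K * ∑ v ∈ A, 2 ^ κ v)) := by
        gcongr
        exact hdeg.trans (by gcongr)
    _ = 8 * d / K * ∑ v ∈ A, 2 ^ κ v := by ring

lemma exists_dense_pair (κ : V → ℕ) (A : Finset V) {k : ℕ} (hk : 0 < k)
    (hκ : ∀ v ∈ A, κ v < k) :
    ∃ i j, i ≤ j ∧
      ∑ v ∈ A, degIn G A v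
        ≤ k ^ 2 * ∑ v ∈ {v ∈ A | κ v = j}, degIn G {u ∈ A | κ u = i} v := by
  have hk' : (0 : ℝ) < k := by exact_mod_cast hk
  have hmaps : ∀ v ∈ A, κ v ∈ Finset.range k := fun v hv => Finset.mem_range.2 (hκ v hv)
  obtain ⟨p, -, hp⟩ : ∃ p ∈ Finset.range k ×ˢ Finset.range k,
      (∑ v ∈ A, degIn G A v) / k ^ 2
        ≤ ∑ v ∈ {v ∈ A | κ v = p.2}, degIn G {u ∈ A | κ u = p.1} v := by
    refine Finset.exists_le_of_sum_le ⟨(0, 0), by simp [hk]⟩ ?_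
    rw [Finset.sum_const, nsmul_eq_mul, Finset.card_product, Finset.card_range,
      Finset.sum_product_right]
    refine le_of_eq ?_
    have hinner : ∀ v, ∑ i ∈ Finset.range k, degIn G {u ∈ A | κ u = i} v = degIn G A v :=
      fun v => Finset.sum_fiberwise_of_maps_to hmaps _
    calc ((k * k : ℕ) : ℝ) * ((∑ v ∈ A, degIn G A v) / k ^ 2) = ∑ v ∈ A, degIn G A v := by
          push_cast; field_simp
      _ = ∑ j ∈ Finset.range k, ∑ v ∈ {v ∈ A | κ v = j}, degIn G A v :=
          (Finset.sum_fiberwise_of_maps_to hmaps _).symm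
      _ = _ := Finset.sum_congr rfl fun j _ =>
          (Finset.sum_congr rfl fun v _ => (hinner v).symm).trans Finset.sum_comm
  rw [div_le_iff₀' (by positivity)] at hp
  rcases le_total p.1 p.2 with h | h
  · exact ⟨p.1, p.2, h, hp⟩
  · refine ⟨p.2, p.1, h, ?_⟩
    rwa [sum_degIn_comm G _ {u ∈ A | κ u = p.2}]

/-- A set split into few dyadic degree classes and spanning many edges contains an
almost-regular induced subgraph. -/
lemma exists_almost_regular [DecidableEq V] {d n k : ℕ} (hd : 0 < d) (hn : 0 < n)
    (hk : 0 < k)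
    (hG : Degenerate G d) (κ : V → ℕ) (A : Finset V) (hκk : ∀ v ∈ A, κ v < k)
    (hκ : ∀ v ∈ A, degIn G A v ≤ 2 ^ (κ v + 1) * d)
    (hsum : ∑ v ∈ A, (2 : ℝ) ^ κ v ≤ 3 * n)
    (hA : (n * d : ℝ) / 2 ≤ ∑ v ∈ A, degIn G A v) :
    ∃ (H : Finset V) (α : ℝ), d ≤ 48 * k ^ 2 * α ∧ α ≤ (∑ v ∈ H, degIn G H v) / #H ∧
      ∀ v ∈ H, degIn G H v ≤ 4896 * k ^ 2 * α := by
  have hd' : (1 : ℝ) ≤ d := by exact_mod_cast hd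
  have hn' : (0 : ℝ) < n := by exact_mod_cast hn
  have hk' : (0 : ℝ) < k := by exact_mod_cast hk
  obtain ⟨A', hA', hint, hedge⟩ := exists_pruning G hd hG κ A hκ (K := 96) (by norm_num)
  have hedge_pruned : (n * d : ℝ) / 4 ≤ ∑ v ∈ A', degIn G A' v := by
    have : 8 * (d : ℝ) / 96 * ∑ v ∈ A, (2 : ℝ) ^ κ v ≤ 8 * d / 96 * (3 * n) := by gcongr
    linarith
  obtain ⟨i, j, hij, hpair⟩ := exists_dense_pair G κ A' hk fun v hv => hκk v (hA' hv)
  set P := {u ∈ A' | κ u = i} with hP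
  set Q := {v ∈ A' | κ v = j} with hQ
  have hsize : ∀ l, (#{v ∈ A' | κ v = l} : ℝ) * 2 ^ l ≤ 3 * n := by
    intro l
    refine le_trans ?_ hsum
    rw [← nsmul_eq_mul]
    refine (Finset.card_nsmul_le_sum _ (fun v => (2 : ℝ) ^ κ v) _ fun v hv => ?_).trans
      (Finset.sum_le_sum_of_subset_of_nonneg ((Finset.filter_subset _ _).trans hA')
        fun _ _ _ => by positivity)
    rw [(Finset.mem_filter.1 hv).2]
  have hdegA : ∀ l, ∀ v ∈ A', κ v = l → ∀ s ⊆ A', degIn G s v ≤ 2 * 2 ^ l * d := by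
    rintro l v hv rfl s hs
    refine (degIn_mono G (hs.trans hA') v).trans ((hκ v (hA' hv)).trans (le_of_eq ?_))
    ring
  have hPA : P ⊆ A' := Finset.filter_subset _ _
  have hQA : Q ⊆ A' := Finset.filter_subset _ _
  have hpow : (2 : ℝ) ^ (j - i) * 2 ^ i = 2 ^ j := by
    rw [← pow_add, Nat.sub_add_cancel hij]
  have h2i : (1 : ℝ) ≤ 2 ^ i := one_le_pow₀ (by norm_num)
  set x : ℝ := 2 ^ i with hx
  set e := ∑ v ∈ Q, degIn G P v with he
  have hepos : (n * d : ℝ) / 4 ≤ k ^ 2 * e := hedge_pruned.trans hpair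
  set α : ℝ := x * d / (48 * k ^ 2) with hα
  have hαpos : 0 < α := by positivity
  have hxd : x * d = 48 * k ^ 2 * α := by rw [hα]; field_simp
  have h1xd : 1 ≤ x * d := one_le_mul_of_one_le_of_one_le h2i hd'
  have he0 : 0 ≤ e := Finset.sum_nonneg fun _ _ => degIn_nonneg G _ _
  obtain ⟨S, hSP, R, hRQ, hRt, hSR⟩ := exists_sparsification G P Q (q := 2 ^ (j - i))
    (D := 2 * (x * d)) (t := 6 * (x * d)) (α := α) (by positivity) (by positivity)
    (fun v hv => by
      refine (hdegA j v (hQA hv) (Finset.mem_filter.1 hv).2 P hPA).trans (le_of_eq ?_)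
      push_cast
      rw [← hpow]
      ring)
    (by
      have h1 : (1 + 2 * (x * d)) / (6 * (x * d)) ≤ 1 / 2 := by
        rw [div_le_div_iff₀ (by positivity) (by norm_num)]
        linarith
      have h2 : e * (1 / 2) ≤ e * (1 - (1 + 2 * (x * d)) / (6 * (x * d))) :=
        mul_le_mul_of_nonneg_left (by linarith) he0
      refine le_trans ?_ h2
      have h3 : (#P : ℝ) * x ≤ 3 * n := hsize i
      have h4 : (2 : ℝ) ^ (j - i) * #Q * x ≤ 3 * n := by
        refine le_trans (le_of_eq ?_) (hsize j)
        rw [← hpow]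
        ring
      rw [hα, div_mul_eq_mul_div, div_le_iff₀ (by positivity)]
      push_cast
      have h5 : x * d * (#P + 2 ^ (j - i) * #Q) ≤ d * (6 * n) := by
        calc x * d * (#P + 2 ^ (j - i) * #Q) = d * (#P * x + 2 ^ (j - i) * #Q * x) := by ring
          _ ≤ d * (6 * n) := mul_le_mul_of_nonneg_left (by linarith) (by linarith)
      linarith)
  have hQne : 0 < (#Q : ℝ) := by
    rcases Q.eq_empty_or_nonempty with h | h
    · exfalso
      have : e = 0 := by rw [he, h, Finset.sum_empty]
      rw [this, mul_zero] at hepos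
      have : (0 : ℝ) < n * d := mul_pos hn' (by linarith)
      linarith
    · exact_mod_cast h.card_pos
  have hHcard : (#(S ∪ R) : ℝ) ≤ #S + #Q := by
    exact_mod_cast (Finset.card_union_le S R).trans
      (Nat.add_le_add_left (Finset.card_le_card hRQ) _)
  have hHsum : ∑ v ∈ R, degIn G S v ≤ ∑ v ∈ S ∪ R, degIn G (S ∪ R) v :=
    (Finset.sum_le_sum fun v _ => degIn_mono G Finset.subset_union_left v).trans
      (Finset.sum_le_sum_of_subset_of_nonneg Finset.subset_union_right
        fun _ _ _ => degIn_nonneg G _ _)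
  have hHne : 0 < (#(S ∪ R) : ℝ) := by
    rcases (S ∪ R).eq_empty_or_nonempty with h | h
    · exfalso
      rw [h, Finset.sum_empty] at hHsum
      have : 0 < α * (#S + #Q) :=
        mul_pos hαpos (add_pos_of_nonneg_of_pos (Nat.cast_nonneg _) hQne)
      linarith
    · exact_mod_cast h.card_pos
  refine ⟨S ∪ R, α, ?_, ?_, fun v hv => ?_⟩
  · rw [← hxd]
    exact le_mul_of_one_le_left (by linarith) h2i
  · rw [le_div_iff₀ hHne]
    exact (mul_le_mul_of_nonneg_left hHcard hαpos.le).trans (hSR.trans hHsum)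
  · have hbound : degIn G (S ∪ R) v ≤ 102 * (x * d) := by
      rcases Finset.mem_union.1 hv with h | h
      · have hvP := Finset.mem_filter.1 (hSP h)
        have := hdegA i v hvP.1 hvP.2 (S ∪ R)
          (Finset.union_subset (hSP.trans hPA) (hRQ.trans hQA))
        linarith
      · obtain ⟨hvA, hvj⟩ := Finset.mem_filter.1 (hRQ h)
        have h1 := hint v hvA
        rw [hvj] at h1
        have h2 := degIn_mono G hRQ v
        have h3 := hRt v h
        have h4 := degIn_union_le G S R v
        have h5 : (d : ℝ) ≤ x * d := le_mul_of_one_le_left (by linarith) h2i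
        linarith
    linarith

end Classes

/-- The dyadic class of a non-negative real. -/
lemma exists_dyadic_class {x : ℝ} (hx : 0 ≤ x) :
    ∃ j : ℕ, x ≤ 2 ^ (j + 1) ∧ (2 : ℝ) ^ j ≤ 1 + x ∧ ∀ M : ℕ, x ≤ M → j ≤ Nat.log 2 M := by
  refine ⟨Nat.log 2 ⌊x⌋₊, ?_, ?_, fun M hM => Nat.log_mono_right ?_⟩
  · have h := Nat.lt_pow_succ_log_self (b := 2) (by norm_num) ⌊x⌋₊
    have h2 : ((⌊x⌋₊ + 1 : ℕ) : ℝ) ≤ ((2 ^ (Nat.log 2 ⌊x⌋₊ + 1) : ℕ) : ℝ) := by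
      exact_mod_cast h
    push_cast at h2
    linarith [Nat.lt_floor_add_one x]
  · rcases Nat.eq_zero_or_pos ⌊x⌋₊ with h | h
    · rw [h]
      simpa using hx
    · have h1 := Nat.pow_log_le_self 2 h.ne'
      have h2 : ((2 ^ Nat.log 2 ⌊x⌋₊ : ℕ) : ℝ) ≤ (⌊x⌋₊ : ℝ) := by exact_mod_cast h1
      push_cast at h2
      linarith [Nat.floor_le hx]
  · exact Nat.floor_le_of_le hM

lemma log_add_two_le {L : ℕ} (hL : 16 ≤ L) :
    ((Nat.log 2 (L + 2) + 1 : ℕ) : ℝ) ≤ 2 * Real.logb 2 L := by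
  have hL' : (16 : ℝ) ≤ L := by exact_mod_cast hL
  have h1 : (Nat.log 2 (L + 2) : ℝ) ≤ Real.logb 2 ((L + 2 : ℕ) : ℝ) := Real.natLog_le_logb _ _
  have h2 : Real.logb 2 ((L + 2 : ℕ) : ℝ) ≤ Real.logb 2 (2 * L) :=
    Real.logb_le_logb_of_le (by norm_num) (by positivity) (by push_cast; linarith)
  have h3 : Real.logb 2 (2 * L) = 1 + Real.logb 2 L := by
    rw [Real.logb_mul (by norm_num) (by positivity), Real.logb_self_eq_one (by norm_num)]
  have h4 : 4 ≤ Real.logb 2 L := by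
    rw [Real.le_logb_iff_rpow_le (by norm_num) (by positivity)]
    norm_num
    exact_mod_cast hL
  push_cast
  linarith

end AlmostRegular

open AlmostRegular

/-- The dichotomy: there are absolute constants `c, C > 0` such that
for all integers `L, d ≥ 16`, every `d`-degenerate `n`-vertex graph of average degree at
least `d` admits an unbalanced bipartition retaining `nd/8` edges, or an almost-regular
induced subgraph. -/
theorem stmt8 :
    ∃ c C : ℝ, 0 < c ∧ 0 < C ∧
      ∀ L d : ℕ, 16 ≤ L → 16 ≤ d →
        ∀ (V : Type) [Fintype V] [DecidableEq V] (G : SimpleGraph V),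
          avgDeg G ≥ (d : ℝ) → Degenerate G d →
          (∃ A B : Finset V, Disjoint A B ∧ A ∪ B = Finset.univ ∧
              (A.card : ℝ) ≥ (L : ℝ) * (B.card : ℝ) / 2 ∧
              (crossEdges G (A : Set V) (B : Set V) : ℝ)
                ≥ (Fintype.card V : ℝ) * (d : ℝ) / 8) ∨
          (∃ s : Finset V,
              (∀ v, (deg (G.induce (s : Set V)) v : ℝ)
                  ≤ C * avgDeg (G.induce (s : Set V)) * (Real.logb 2 (L : ℝ)) ^ 2) ∧
              avgDeg (G.induce (s : Set V)) ≥ c * (d : ℝ) / (Real.logb 2 (L : ℝ)) ^ 2) := by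
  refine ⟨1 / 192, 19584, by norm_num, by norm_num, ?_⟩
  intro L d hL hd V _ _ G havg hG
  have hd' : (16 : ℝ) ≤ d := by exact_mod_cast hd
  have hd0 : (0 : ℝ) < d := by linarith
  have hL' : (16 : ℝ) ≤ L := by exact_mod_cast hL
  rw [avgDeg_eq] at havg
  set n := Fintype.card V with hn
  have hn0 : 0 < n := by
    rcases Nat.eq_zero_or_pos n with h | h
    · rw [h] at havg
      simp at havg
      linarith
    · exact h
  have hn' : (0 : ℝ) < n := by exact_mod_cast hn0
  rw [ge_iff_le, le_div_iff₀ hn'] at havg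
  set T := ∑ v, degIn G Finset.univ v with hT
  have hTle : T ≤ 2 * d * n := by
    simpa [hn] using sum_degIn_le_of_degenerate G hG Finset.univ
  set B : Finset V := {v | (L + 2) * d < degIn G Finset.univ v} with hB
  have hBcard : (#B : ℝ) * (L + 2) ≤ 2 * n := by
    have h1 : #B * ((L + 2) * d) ≤ T := by
      rw [← nsmul_eq_mul]
      exact (Finset.card_nsmul_le_sum _ _ _ fun v hv => (Finset.mem_filter.1 hv).2.le).trans
        (Finset.sum_le_sum_of_subset_of_nonneg (Finset.subset_univ _)
          fun _ _ _ => degIn_nonneg G _ _)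
    nlinarith
  have hsplit : (#(univ \ B) : ℝ) + #B = n := by
    exact_mod_cast Finset.card_sdiff_add_card_eq_card (Finset.subset_univ B)
  by_cases hcross : (n : ℝ) * d / 8 ≤ crossEdges G ((univ \ B : Finset V) : Set V) (B : Set V)
  · refine Or.inl ⟨univ \ B, B, Finset.sdiff_disjoint, by simp, ?_, hcross⟩
    linarith
  right
  rw [crossEdges_eq, not_le] at hcross
  set A := univ \ B with hA
  have hAsum : (n * d : ℝ) / 2 ≤ ∑ v ∈ A, degIn G A v := by
    have h1 : ∀ v, degIn G univ v = degIn G A v + degIn G B v := fun v =>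
      (Finset.sum_sdiff (Finset.subset_univ B)).symm
    have h2 : T = (∑ v ∈ A, degIn G A v + ∑ v ∈ A, degIn G B v)
        + (∑ v ∈ B, degIn G A v + ∑ v ∈ B, degIn G B v) := by
      rw [hT, ← Finset.sum_sdiff (Finset.subset_univ B), ← Finset.sum_add_distrib,
        ← Finset.sum_add_distrib]
      simp only [h1, hA]
    rw [sum_degIn_comm G B A] at h2
    have h3 := sum_degIn_le_of_degenerate G hG B
    have h4 : (#B : ℝ) * 18 ≤ 2 * n :=
      le_trans (mul_le_mul_of_nonneg_left (by linarith) (Nat.cast_nonneg _)) hBcard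
    have h5 : 2 * d * (#B : ℝ) ≤ 2 * d * (n / 9) :=
      mul_le_mul_of_nonneg_left (by linarith) (by positivity)
    have : 0 < n * (d : ℝ) := by positivity
    linarith
  choose κ hκ1 hκ2 hκ3 using fun v : V =>
    exists_dyadic_class (div_nonneg (degIn_nonneg G univ v) hd0.le)
  obtain ⟨H, α, h1, h2, h3⟩ := exists_almost_regular G (k := Nat.log 2 (L + 2) + 1)
    (by omega) hn0 (Nat.succ_pos _) hG κ A
    (fun v hv => by
      refine Nat.lt_succ_of_le (hκ3 v (L + 2) ?_)
      rw [div_le_iff₀ hd0]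
      push_cast
      by_contra h
      exact (Finset.mem_sdiff.1 hv).2 (Finset.mem_filter.2 ⟨Finset.mem_univ _, not_le.1 h⟩))
    (fun v _ => by
      have := hκ1 v
      rw [div_le_iff₀ hd0] at this
      exact (degIn_mono G (Finset.subset_univ _) v).trans this)
    (by
      calc ∑ v ∈ A, (2 : ℝ) ^ κ v ≤ ∑ v, (2 : ℝ) ^ κ v :=
            Finset.sum_le_sum_of_subset_of_nonneg (Finset.subset_univ _)
              fun _ _ _ => by positivity
        _ ≤ ∑ v, (1 + degIn G univ v / d) := Finset.sum_le_sum fun v _ => hκ2 v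
        _ = n + T / d := by
            rw [Finset.sum_add_distrib, ← Finset.sum_div]
            simp [hn, hT]
        _ ≤ 3 * n := by
            have : T / d ≤ 2 * n := by
              rw [div_le_iff₀ hd0]
              linarith
            linarith)
    hAsum
  have hk := log_add_two_le hL
  set k : ℝ := ((Nat.log 2 (L + 2) + 1 : ℕ) : ℝ) with hkdef
  have hk0 : 0 < k := by rw [hkdef]; positivity
  have hk2 : k ^ 2 ≤ 4 * Real.logb 2 L ^ 2 := by nlinarith
  have hlog : 0 < Real.logb 2 L ^ 2 := by nlinarith
  have hα : 0 < α := by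
    by_contra h
    have : 48 * k ^ 2 * α ≤ 0 :=
      mul_nonpos_of_nonneg_of_nonpos (by positivity) (not_lt.1 h)
    linarith
  have hkα : k ^ 2 * α ≤ 4 * Real.logb 2 L ^ 2 * α := mul_le_mul_of_nonneg_right hk2 hα.le
  refine ⟨H, fun v => ?_, ?_⟩
  · rw [deg_induce, avgDeg_induce]
    have h4 := mul_le_mul_of_nonneg_right h2 hlog.le
    have h5 := h3 v v.2
    linarith
  · rw [avgDeg_induce, ge_iff_le, div_le_iff₀ hlog]
    have h4 := mul_le_mul_of_nonneg_right h2 hlog.le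
    linarith
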